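/- Let Q ≥ 3 be an integer, A = A_{𝔾^Q}, Z a fixed two-sided infinite geodesic in 𝔾^Q, and N ⊂ Z a one-sided infinite geodesic ray. Then for every λ > 2√(Q−1), ‖P_{ℓ²(Z)} R_A(λ) P_{ℓ²(Z)}‖ = ‖P_{ℓ²(N)} R_A(λ) P_{ℓ²(N)}‖ = (1 + a(λ)) / (μ(λ)(1 − a(λ))), where a(λ) = λ(1 − √(1 − 4(Q−1)/λ²))/(2(Q−1)) and μ(λ) = λ(Q−2 + Q√(1 − 4(Q−1)/λ²))/(2(Q−1)). -/

import Mathlib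

open Filter MeasureTheory Set
open scoped Topology Classical ENNReal

noncomputable section

/-- The Hilbert space ℓ²(V) with complex coefficients. -/
abbrev L2 (V : Type) := lp (fun _ : V => ℂ) 2

/-- The coordinate (delta) vector at a vertex `x`. -/
def delta {V : Type} (x : V) : L2 V :=
  haveI := Classical.decEq V; lp.single 2 x 1

/-- The matrix entry `B_{x y} = (B δ_y)(x)` of a bounded operator on ℓ²(V). -/
def entry {V : Type} (B : L2 V →L[ℂ] L2 V) (x y : V) : ℂ :=
  (B (delta y) : ∀ _ : V, ℂ) x

/-- The resolvent `R_B(z) = (z·1 − B)⁻¹` (junk value if not invertible). -/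
def Res {V : Type} (B : L2 V →L[ℂ] L2 V) (z : ℂ) : L2 V →L[ℂ] L2 V :=
  Ring.inverse (z • (1 : L2 V →L[ℂ] L2 V) - B)

/-- The resolvent at a real point. -/
def ResR {V : Type} (B : L2 V →L[ℂ] L2 V) (l : ℝ) : L2 V →L[ℂ] L2 V :=
  Res B (l : ℂ)

/-- `G` is the homogeneous Cayley tree of degree `Q`: connected, acyclic,
and every vertex has exactly `Q` neighbours. -/
structure IsCayleyTree {V : Type} (G : SimpleGraph V) (Q : ℕ) : Prop where
  conn : G.Connected
  acyc : G.IsAcyclic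
  deg : ∀ v : V, (G.neighborSet v).ncard = Q

/-- `A` is the adjacency operator of the simple graph `G` on ℓ²(V). -/
def IsAdjacencyOp {V : Type} (G : SimpleGraph V) (A : L2 V →L[ℂ] L2 V) : Prop :=
  ∀ x y : V, entry A x y = if G.Adj x y then 1 else 0

/-- `P` assigns to each subset `S ⊆ V` the orthogonal projection of ℓ²(V) onto ℓ²(S). -/
def IsProjFamily {V : Type} (P : Set V → (L2 V →L[ℂ] L2 V)) : Prop :=
  ∀ (S : Set V) (f : L2 V) (x : V),
    (P S f : ∀ _ : V, ℂ) x = if x ∈ S then (f : ∀ _ : V, ℂ) x else 0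

/-- `S` is the vertex set of a connected subtree of `G` in which every vertex has
exactly `q` neighbours within `S` (a subtree of constant internal degree `q`). -/
def IsRegularSubtree {V : Type} (G : SimpleGraph V) (S : Set V) (q : ℕ) : Prop :=
  (G.induce S).Connected ∧ ∀ x ∈ S, {y : V | y ∈ S ∧ G.Adj x y}.ncard = q

/-- Distance from a vertex to a set of vertices. -/
def distToSet {V : Type} (G : SimpleGraph V) (x : V) (S : Set V) : ℕ :=
  sInf {n : ℕ | ∃ y ∈ S, G.dist x y = n}

/-- `a(λ)` of equation (4.2) of the paper, for the tree of degree `Q`. -/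
def aF (Q : ℕ) (l : ℝ) : ℝ :=
  l * (1 - Real.sqrt (1 - 4 * ((Q : ℝ) - 1) / l ^ 2)) / (2 * ((Q : ℝ) - 1))

/-- `μ(λ)` of equation (4.3) of the paper, for the tree of degree `Q`. -/
def muF (Q : ℕ) (l : ℝ) : ℝ :=
  l * (((Q : ℝ) - 2) + (Q : ℝ) * Real.sqrt (1 - 4 * ((Q : ℝ) - 1) / l ^ 2)) /
    (2 * ((Q : ℝ) - 1))

/-- `M` realizes the inverse, within the corner algebra `P·B(ℓ²)·P`, of the operator
`P − P T P` (that is, of `I_{ℓ²(S)} − S(λ)` when `T` is the resolvent and `P = P_{ℓ²(S)}`). -/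
def IsCornerInverse {V : Type} (P M T : L2 V →L[ℂ] L2 V) : Prop :=
  P ∘L M = M ∧ M ∘L P = M ∧
    M ∘L (P - P ∘L T ∘L P) = P ∧ (P - P ∘L T ∘L P) ∘L M = P

namespace SimpleGraph

variable {W : Type*} {G : SimpleGraph W}

theorem IsTree.eq_of_adj_of_dist_eq (hG : G.IsTree) {o x y z : W} (hy : G.Adj y x)
    (hz : G.Adj z x) (hdy : G.dist o x = G.dist o y + 1) (hdz : G.dist o x = G.dist o z + 1) :
    y = z := by
  obtain ⟨p, -, hp⟩ := hG.connected.exists_path_of_dist o y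
  obtain ⟨r, -, hr⟩ := hG.connected.exists_path_of_dist o z
  have hp' := (p.concat hy).isPath_of_length_eq_dist (by simp [hp, hdy])
  have hr' := (r.concat hz).isPath_of_length_eq_dist (by simp [hr, hdz])
  have h := congrArg (fun w : G.Path o x => w.1.penultimate)
    ((hG.isAcyclic.subsingleton_path o x).elim ⟨_, hp'⟩ ⟨_, hr'⟩)
  simpa using h

theorem IsTree.exists_adj_dist_eq (hG : G.IsTree) {o x : W} (hx : x ≠ o) :
    ∃ y, G.Adj y x ∧ G.dist o x = G.dist o y + 1 := by
  obtain ⟨p, -, hp⟩ := hG.connected.exists_path_of_dist o x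
  have hnil : ¬ p.Nil := fun h => hx h.eq.symm
  have hadj := p.adj_penultimate hnil
  refine ⟨p.penultimate, hadj, ?_⟩
  rcases hG.dist_eq_dist_add_one_of_adj o hadj with h | h
  · exfalso
    have h1 := G.dist_le p.dropLast
    have h2 := p.length_dropLast_add_one hnil
    omega
  · exact h

theorem IsTree.sum_neighborFinset_dist [G.LocallyFinite] (hG : G.IsTree) {q : ℕ}
    (hdeg : G.IsRegularOfDegree (q + 1)) (o x : W) (n : ℕ) (hx : G.dist o x = n + 1) (f : ℕ → ℝ) :
    ∑ y ∈ G.neighborFinset x, f (G.dist o y) = f n + q * f (n + 2) := by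
  obtain ⟨p, hp, hd⟩ := hG.exists_adj_dist_eq (o := o) (x := x)
    (by rintro rfl; simp at hx)
  have hmem : p ∈ G.neighborFinset x := by simpa using hp.symm
  rw [← Finset.add_sum_erase _ _ hmem, Finset.sum_congr rfl (g := fun _ => f (n + 2))]
  · have : G.dist o p = n := by omega
    rw [Finset.sum_const, Finset.card_erase_of_mem hmem, G.card_neighborFinset_eq_degree,
      hdeg.degree_eq, this]
    simp
  · intro y hy
    rw [Finset.mem_erase, mem_neighborFinset] at hy
    rcases hG.dist_eq_dist_add_one_of_adj o hy.2 with h | h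
    · exact absurd (hG.eq_of_adj_of_dist_eq hy.2.symm hp h hd) hy.1
    · rw [h, hx]

theorem IsRegularOfDegree.sum_neighborFinset_dist_self [G.LocallyFinite] {q : ℕ}
    (hdeg : G.IsRegularOfDegree (q + 1)) (o : W) (f : ℕ → ℝ) :
    ∑ y ∈ G.neighborFinset o, f (G.dist o y) = (q + 1) * f 1 := by
  rw [Finset.sum_congr rfl (g := fun _ => f 1)]
  · rw [Finset.sum_const, G.card_neighborFinset_eq_degree, hdeg.degree_eq]
    simp
  · intro y hy
    rw [mem_neighborFinset] at hy
    rw [dist_eq_one_iff_adj.2 hy]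

theorem IsTree.card_filter_dist_le [G.LocallyFinite] (hG : G.IsTree) {q : ℕ}
    (hdeg : G.IsRegularOfDegree (q + 1)) {o x : W} (hx : x ≠ o) :
    ((G.neighborFinset x).filter (fun y => G.dist o y = G.dist o x + 1)).card ≤ q := by
  obtain ⟨p, hp, hd⟩ := hG.exists_adj_dist_eq hx
  have hmem : p ∈ G.neighborFinset x := by simpa using hp.symm
  calc _ ≤ ((G.neighborFinset x).erase p).card := by
        refine Finset.card_le_card fun y hy => ?_
        rw [Finset.mem_filter] at hy
        exact Finset.mem_erase.2 ⟨by rintro rfl; omega, hy.1⟩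
    _ = q := by
        rw [Finset.card_erase_of_mem hmem, G.card_neighborFinset_eq_degree, hdeg.degree_eq]
        simp

/-- In a `(q + 1)`-regular tree the radial geometric series of ratio `b < 1 / q` converges, with
the bound given by the exact sphere sizes. -/
theorem IsTree.sum_pow_dist_le [G.LocallyFinite] (hG : G.IsTree) {q : ℕ}
    (hdeg : G.IsRegularOfDegree (q + 1)) (o : W) {b : ℝ} (hb : 0 ≤ b) (hqb : q * b < 1)
    (F : Finset W) : ∑ x ∈ F, b ^ G.dist o x ≤ (1 + b) / (1 - q * b) := by
  have hpos : 0 < 1 - q * b := by linarith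
  have hC : 1 + b + q * b * ((1 + b) / (1 - q * b)) = (1 + b) / (1 - q * b) := by
    rw [mul_div_assoc', eq_div_iff hpos.ne', add_mul, div_mul_cancel₀ _ hpos.ne']
    ring
  have hC0 : 0 ≤ (1 + b) / (1 - q * b) := by positivity
  have hqb0 : 0 ≤ q * b := by positivity
  have split (F : Finset W) :
      ∑ x ∈ F, b ^ G.dist o x ≤ 1 + ∑ x ∈ F.erase o, b ^ G.dist o x := by
    by_cases ho : o ∈ F
    · rw [← Finset.add_sum_erase _ _ ho]
      simp
    · rw [Finset.erase_eq_of_notMem ho]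
      linarith
  have key : ∀ n : ℕ, ∀ F : Finset W, (∀ x ∈ F, G.dist o x ≤ n) →
      ∑ x ∈ F, b ^ G.dist o x ≤ (1 + b) / (1 - q * b) := by
    intro n
    induction n with
    | zero =>
      intro F hF
      have : F.erase o = ∅ := by
        refine Finset.eq_empty_of_forall_notMem fun x hx => ?_
        have h := hF x (Finset.mem_of_mem_erase hx)
        exact (Finset.ne_of_mem_erase hx)
          ((hG.connected.dist_eq_zero_iff.1 (Nat.le_zero.1 h)).symm)
      have h := split F
      rw [this, Finset.sum_empty] at h
      have : 0 ≤ q * b * ((1 + b) / (1 - q * b)) := by positivity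
      linarith
    | succ n ih =>
      intro F hF
      have hpar : ∀ x, ∃ y, x ≠ o → G.Adj y x ∧ G.dist o x = G.dist o y + 1 := by
        intro x
        by_cases hx : x = o
        · exact ⟨o, fun h => absurd hx h⟩
        · obtain ⟨y, hy⟩ := hG.exists_adj_dist_eq hx
          exact ⟨y, fun _ => hy⟩
      choose par hpar using hpar
      set I := (F.erase o).image par
      have hmaps : ∀ x ∈ F.erase o, par x ∈ I := fun x hx => Finset.mem_image_of_mem _ hx
      have hIn : ∀ p ∈ I, G.dist o p ≤ n := by
        intro p hp
        obtain ⟨x, hx, rfl⟩ := Finset.mem_image.1 hp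
        have h1 := (hpar x (Finset.ne_of_mem_erase hx)).2
        have h2 := hF x (Finset.mem_of_mem_erase hx)
        omega
      have hfib : ∀ p ∈ I, ∑ x ∈ (F.erase o).filter (fun x => par x = p), b ^ G.dist o x ≤
          (if p = o then b else 0) + q * b * b ^ G.dist o p := by
        intro p _
        have hsub : (F.erase o).filter (fun x => par x = p) ⊆
            (G.neighborFinset p).filter (fun y => G.dist o y = G.dist o p + 1) := by
          intro x hx
          rw [Finset.mem_filter] at hx
          have h := hpar x (Finset.ne_of_mem_erase hx.1)
          rw [hx.2] at h
          simpa using h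
        calc _ ≤ ∑ x ∈ (G.neighborFinset p).filter (fun y => G.dist o y = G.dist o p + 1),
                b ^ G.dist o x :=
              Finset.sum_le_sum_of_subset_of_nonneg hsub fun _ _ _ => by positivity
          _ = ((G.neighborFinset p).filter (fun y => G.dist o y = G.dist o p + 1)).card *
                b ^ (G.dist o p + 1) := by
              rw [Finset.sum_congr rfl (g := fun _ => b ^ (G.dist o p + 1)), Finset.sum_const,
                nsmul_eq_mul]
              intro x hx
              rw [(Finset.mem_filter.1 hx).2]
          _ ≤ _ := by
              by_cases hp : p = o
              · have hle := Finset.card_filter_le (G.neighborFinset p)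
                  (fun y => G.dist o y = G.dist o p + 1)
                rw [G.card_neighborFinset_eq_degree, hdeg.degree_eq] at hle
                have hle' : (((G.neighborFinset p).filter
                  (fun y => G.dist o y = G.dist o p + 1)).card : ℝ) ≤ q + 1 := by
                  exact_mod_cast hle
                rw [if_pos hp]
                subst hp
                simp only [dist_self, zero_add, pow_zero, pow_one, mul_one] at hle' ⊢
                linarith [mul_le_mul_of_nonneg_right hle' hb]
              · have hle := hG.card_filter_dist_le hdeg hp
                have hle' : (((G.neighborFinset p).filter
                  (fun y => G.dist o y = G.dist o p + 1)).card : ℝ) ≤ q := by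
                  exact_mod_cast hle
                rw [if_neg hp, zero_add, pow_succ', ← mul_assoc]
                gcongr
      have h1 : ∑ x ∈ F.erase o, b ^ G.dist o x ≤
          b + q * b * ∑ p ∈ I, b ^ G.dist o p := by
        rw [← Finset.sum_fiberwise_of_maps_to hmaps]
        refine (Finset.sum_le_sum hfib).trans ?_
        rw [Finset.sum_add_distrib, ← Finset.mul_sum, Finset.sum_ite_eq']
        gcongr
        split_ifs <;> linarith
      have h2 := mul_le_mul_of_nonneg_left (ih I hIn) hqb0
      linarith [split F]
  exact key (F.sup (G.dist o)) F fun x hx => Finset.le_sup hx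

theorem IsAcyclic.dist_induce (hG : G.IsAcyclic) {S : Set W} (hS : (G.induce S).Connected)
    (x y : S) : (G.induce S).dist x y = G.dist x y := by
  obtain ⟨p, hp, hlen⟩ := hS.exists_path_of_dist x y
  let φ := (Embedding.induce S : G.induce S ↪g G)
  have hp' : (p.map φ.toHom).IsPath := hp.map φ.injective
  obtain ⟨r, hr, hrlen⟩ := (p.map φ.toHom).reachable.exists_path_of_dist
  have h := congrArg (fun w : G.Path _ _ => w.1.length) ((hG.subsingleton_path _ _).elim ⟨_, hp'⟩ ⟨_, hr⟩)
  simp only [Walk.length_map] at h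
  rw [← hlen, h, hrlen]
  rfl

theorem IsTree.dist_of_injective_of_adj (hG : G.IsTree) {ray : ℕ → W}
    (hinj : Function.Injective ray) (hadj : ∀ k, G.Adj (ray k) (ray (k + 1))) (i n : ℕ) :
    G.dist (ray i) (ray (i + n)) = n := by
  have h : G.dist (ray i) (ray (i + n)) = n ∧ G.dist (ray i) (ray (i + n + 1)) = n + 1 := by
    induction n with
    | zero => simpa using hadj i
    | succ n ih =>
      refine ⟨ih.2, ?_⟩
      rcases hG.dist_eq_dist_add_one_of_adj (ray i) (hadj (i + n + 1)) with h | h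
      · have := hinj (hG.eq_of_adj_of_dist_eq (hadj (i + n)) (hadj (i + n + 1)).symm
          (ih.2.trans (by rw [ih.1])) h)
        omega
      · rw [← add_assoc, h, ih.2]
  exact h.1

end SimpleGraph

theorem delta_apply {V : Type} (x y : V) :
    (delta y : ∀ _ : V, ℂ) x = if x = y then 1 else 0 := by
  unfold delta
  by_cases h : x = y
  · subst h
    simp
  · rw [lp.single_apply_ne _ _ _ h, if_neg h]

theorem inner_delta_left {V : Type} (x : V) (f : L2 V) :
    inner ℂ (delta x) f = (f : ∀ _ : V, ℂ) x := by
  unfold delta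
  rw [lp.inner_single_left]
  simp

theorem hasSum_smul_delta {V : Type} (f : L2 V) :
    HasSum (fun y => (f : ∀ _ : V, ℂ) y • (delta y : L2 V)) f := by
  let _ := Classical.decEq V
  have h := lp.hasSum_single (p := 2) (by simp) f
  have h' (y : V) : (f : ∀ _ : V, ℂ) y • (delta y : L2 V) =
      lp.single 2 y ((f : ∀ _ : V, ℂ) y) := by
    unfold delta
    rw [← lp.single_smul, smul_eq_mul, mul_one]
  simpa only [h'] using h

/-- The matrix of a bounded operator determines its action. -/
theorem hasSum_mul_entry {V : Type} (T : L2 V →L[ℂ] L2 V) (f : L2 V) (x : V) :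
    HasSum (fun y => (f : ∀ _ : V, ℂ) y * entry T x y) ((T f : ∀ _ : V, ℂ) x) := by
  have h := (hasSum_smul_delta f).mapL ((innerSL ℂ (delta x)).comp T)
  simpa [inner_delta_left, entry] using h

/-- **Schur's test** for a bounded operator with a symmetric nonnegative matrix. -/
theorem opNorm_le_of_schur {V : Type} (T : L2 V →L[ℂ] L2 V) (k : V → V → ℝ)
    (hk : ∀ x y, entry T x y = k x y) (hk0 : ∀ x y, 0 ≤ k x y) (hsymm : ∀ x y, k x y = k y x)
    (w : V → ℝ) (hw : ∀ x, 0 < w x) {C : ℝ} (hC : 0 ≤ C)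
    (hrow : ∀ (x : V) (F : Finset V), ∑ y ∈ F, k x y * w y ≤ C * w x) : ‖T‖ ≤ C := by
  refine T.opNorm_le_bound hC fun f => ?_
  have hlim := (T.continuous.tendsto f).comp (hasSum_smul_delta f)
  refine le_of_tendsto hlim.norm (Eventually.of_forall fun E => ?_)
  have hCf : 0 ≤ C * ‖f‖ := by positivity
  refine lp.norm_le_of_forall_sum_le (by simp) hCf fun F => ?_
  have hE : ∑ y ∈ E, ‖(f : ∀ _ : V, ℂ) y‖ ^ 2 ≤ ‖f‖ ^ 2 := by
    have := lp.sum_rpow_le_norm_rpow (p := 2) (by simp) f E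
    simpa using this
  have hpt (x : V) :
      ‖((T (∑ y ∈ E, (f : ∀ _ : V, ℂ) y • delta y) : L2 V) : ∀ _ : V, ℂ) x‖ ^ 2 ≤
        C * w x * ∑ y ∈ E, k x y * (‖(f : ∀ _ : V, ℂ) y‖ ^ 2 / w y) := by
    have hval : ((T (∑ y ∈ E, (f : ∀ _ : V, ℂ) y • delta y) : L2 V) : ∀ _ : V, ℂ) x =
        ∑ y ∈ E, (f : ∀ _ : V, ℂ) y * k x y := by
      rw [← inner_delta_left, map_sum, inner_sum]
      refine Finset.sum_congr rfl fun y _ => ?_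
      rw [map_smul, inner_smul_right, inner_delta_left, ← hk, entry]
    have hle : ‖∑ y ∈ E, (f : ∀ _ : V, ℂ) y * k x y‖ ≤
        ∑ y ∈ E, k x y * ‖(f : ∀ _ : V, ℂ) y‖ := by
      refine (norm_sum_le _ _).trans (Finset.sum_le_sum fun y _ => ?_)
      rw [norm_mul, Complex.norm_real, Real.norm_of_nonneg (hk0 x y), mul_comm]
    rw [hval]
    calc _ ≤ (∑ y ∈ E, k x y * ‖(f : ∀ _ : V, ℂ) y‖) ^ 2 := by gcongr
      _ ≤ (∑ y ∈ E, k x y * w y) *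
            ∑ y ∈ E, k x y * (‖(f : ∀ _ : V, ℂ) y‖ ^ 2 / w y) := by
        refine Finset.sum_sq_le_sum_mul_sum_of_sq_le_mul _
          (fun y _ => mul_nonneg (hk0 x y) (hw y).le)
          (fun y _ => mul_nonneg (hk0 x y) (div_nonneg (sq_nonneg _) (hw y).le)) fun y _ => ?_
        have := (hw y).ne'
        refine le_of_eq ?_
        field_simp
      _ ≤ _ := by
        gcongr
        · exact Finset.sum_nonneg fun y _ =>
            mul_nonneg (hk0 x y) (div_nonneg (sq_nonneg _) (hw y).le)
        · exact hrow x E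
  have hfin : ∑ x ∈ F, ‖((T (∑ y ∈ E, (f : ∀ _ : V, ℂ) y • delta y) : L2 V) :
      ∀ _ : V, ℂ) x‖ ^ 2 ≤ (C * ‖f‖) ^ 2 := by
    calc _ ≤ ∑ x ∈ F, C * w x * ∑ y ∈ E, k x y * (‖(f : ∀ _ : V, ℂ) y‖ ^ 2 / w y) :=
          Finset.sum_le_sum fun x _ => hpt x
      _ = ∑ y ∈ E, C * (‖(f : ∀ _ : V, ℂ) y‖ ^ 2 / w y) * ∑ x ∈ F, k y x * w x := by
          simp_rw [Finset.mul_sum]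
          rw [Finset.sum_comm]
          refine Finset.sum_congr rfl fun y _ => Finset.sum_congr rfl fun x _ => ?_
          rw [hsymm x y]
          ring
      _ ≤ ∑ y ∈ E, C * (‖(f : ∀ _ : V, ℂ) y‖ ^ 2 / w y) * (C * w y) := by
          refine Finset.sum_le_sum fun y _ => ?_
          have := (hw y).le
          exact mul_le_mul_of_nonneg_left (hrow y F) (by positivity)
      _ = C ^ 2 * ∑ y ∈ E, ‖(f : ∀ _ : V, ℂ) y‖ ^ 2 := by
          rw [Finset.mul_sum]
          refine Finset.sum_congr rfl fun y _ => ?_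
          have := (hw y).ne'
          field_simp
      _ ≤ (C * ‖f‖) ^ 2 := by
          rw [mul_pow]
          gcongr
  simpa using hfin

theorem sum_sum_pow_sub_add_sub {a : ℝ} (ha : a ≠ 1) (n : ℕ) :
    ∑ i ∈ Finset.range n, ∑ j ∈ Finset.range n, a ^ ((i - j) + (j - i)) =
      n * ((1 + a) / (1 - a)) - 2 * a * (1 - a ^ n) / (1 - a) ^ 2 := by
  have ha' : 1 - a ≠ 0 := sub_ne_zero.2 ha.symm
  induction n with
  | zero => simp
  | succ n ih =>
    have h1 : ∑ i ∈ Finset.range n, a ^ ((i - n) + (n - i)) = a * (1 - a ^ n) / (1 - a) := by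
      have h2 : ∑ i ∈ Finset.range n, a ^ ((i - n) + (n - i)) =
          ∑ i ∈ Finset.range n, a * a ^ (n - 1 - i) := by
        refine Finset.sum_congr rfl fun i hi => ?_
        rw [Finset.mem_range] at hi
        rw [← pow_succ']
        congr 1
        omega
      rw [h2, ← Finset.mul_sum, Finset.sum_range_reflect (fun i => a ^ i), geom_sum_eq ha,
        ← neg_div_neg_eq]
      ring
    have h3 : ∑ j ∈ Finset.range n, a ^ ((n - j) + (j - n)) = a * (1 - a ^ n) / (1 - a) := by
      rw [← h1]
      exact Finset.sum_congr rfl fun j _ => by rw [add_comm]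
    simp_rw [Finset.sum_range_succ, Finset.sum_add_distrib]
    rw [ih, h1, h3]
    push_cast
    simp only [Nat.sub_self, add_zero, pow_zero]
    field_simp
    ring

/-- A bounded operator containing the Toeplitz matrix `c * a ^ |i - j|`, `i j : ℕ`, has norm at
least the supremum of its symbol. -/
theorem le_opNorm_of_entry_ray {V : Type} (T : L2 V →L[ℂ] L2 V) {ray : ℕ → V}
    (hinj : Function.Injective ray) {a c : ℝ} (ha0 : 0 ≤ a) (ha : a < 1) (hc : 0 ≤ c)
    (hT : ∀ i j, entry T (ray i) (ray j) = (c * a ^ ((i - j) + (j - i)) : ℝ)) :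
    c * ((1 + a) / (1 - a)) ≤ ‖T‖ := by
  have ha' : 0 < 1 - a := by linarith
  have hbound (n : ℕ) :
      (n : ℝ) * (c * ((1 + a) / (1 - a)) - ‖T‖) ≤ c * (2 * a / (1 - a) ^ 2) := by
    set f : L2 V := ∑ i ∈ Finset.range n, delta (ray i) with hf
    have hff : ‖f‖ ^ 2 = n := by
      have h : inner ℂ f f = (n : ℂ) := by
        conv_lhs => rw [hf]
        simp_rw [sum_inner, inner_sum, inner_delta_left, delta_apply, hinj.eq_iff]
        rw [Finset.sum_congr rfl (g := fun _ => 1)]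
        · simp
        · intro i hi
          rw [Finset.sum_ite_eq, if_pos hi]
      rw [← inner_self_eq_norm_sq (𝕜 := ℂ), h]
      simp
    have hfT : inner ℂ f (T f) =
        ((c * (n * ((1 + a) / (1 - a)) - 2 * a * (1 - a ^ n) / (1 - a) ^ 2) : ℝ) : ℂ) := by
      rw [← sum_sum_pow_sub_add_sub ha.ne, hf, map_sum]
      simp_rw [sum_inner, inner_sum, inner_delta_left]
      rw [Finset.mul_sum, Complex.ofReal_sum]
      refine Finset.sum_congr rfl fun i _ => ?_
      rw [Finset.mul_sum, Complex.ofReal_sum]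
      exact Finset.sum_congr rfl fun j _ => hT i j
    have h1 : ‖inner ℂ f (T f)‖ ≤ n * ‖T‖ := by
      calc _ ≤ ‖f‖ * ‖T f‖ := norm_inner_le_norm _ _
        _ ≤ ‖f‖ * (‖T‖ * ‖f‖) := by gcongr; exact T.le_opNorm f
        _ = n * ‖T‖ := by rw [← hff]; ring
    rw [hfT, Complex.norm_real] at h1
    have h2 := (le_abs_self _).trans h1
    have h3 : 2 * a * (1 - a ^ n) / (1 - a) ^ 2 ≤ 2 * a / (1 - a) ^ 2 := by
      refine div_le_div_of_nonneg_right ?_ (sq_nonneg _)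
      nlinarith [mul_nonneg ha0 (pow_nonneg ha0 n)]
    have h4 := mul_le_mul_of_nonneg_left h3 hc
    linarith
  by_contra! hlt
  obtain ⟨n, hn⟩ := exists_nat_gt (c * (2 * a / (1 - a) ^ 2) / (c * ((1 + a) / (1 - a)) - ‖T‖))
  rw [div_lt_iff₀ (sub_pos.2 hlt)] at hn
  exact absurd (hbound n) (not_le.2 hn)

theorem IsAdjacencyOp.apply_eq_sum {V : Type} {G : SimpleGraph V} [G.LocallyFinite]
    {A : L2 V →L[ℂ] L2 V} (hA : IsAdjacencyOp G A) (f : L2 V) (x : V) :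
    (A f : ∀ _ : V, ℂ) x = ∑ y ∈ G.neighborFinset x, (f : ∀ _ : V, ℂ) y := by
  refine (hasSum_mul_entry A f x).unique ?_
  have h := hasSum_sum_of_ne_finset_zero (L := .unconditional V) (s := G.neighborFinset x)
    (f := fun y => (f : ∀ _ : V, ℂ) y * entry A x y) fun y hy => by
      rw [SimpleGraph.mem_neighborFinset] at hy
      rw [hA, if_neg hy, mul_zero]
  rwa [Finset.sum_congr rfl (g := fun y => (f : ∀ _ : V, ℂ) y)] at h
  intro y hy
  rw [SimpleGraph.mem_neighborFinset] at hy
  rw [hA, if_pos hy, mul_one]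

/-- The adjacency operator of a `(q + 1)`-regular tree has norm at most `2 * √q`. -/
theorem IsAdjacencyOp.opNorm_le {V : Type} {G : SimpleGraph V} [G.LocallyFinite]
    {A : L2 V →L[ℂ] L2 V} (hA : IsAdjacencyOp G A) (hG : G.IsTree) {q : ℕ} (hq : 1 ≤ q)
    (hdeg : G.IsRegularOfDegree (q + 1)) : ‖A‖ ≤ 2 * √(q : ℝ) := by
  obtain ⟨o⟩ := hG.connected.nonempty
  have hq' : (1 : ℝ) ≤ q := by exact_mod_cast hq
  have hs : 0 < √(q : ℝ) := Real.sqrt_pos.2 (by linarith)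
  have hsq : √(q : ℝ) ^ 2 = q := Real.sq_sqrt (by linarith)
  set r := (√(q : ℝ))⁻¹
  have hr0 : 0 < r := inv_pos.2 hs
  have hsr : √(q : ℝ) * r = 1 := mul_inv_cancel₀ hs.ne'
  have hqr : q * r = √(q : ℝ) := by
    calc q * r = √(q : ℝ) * (√(q : ℝ) * r) := by rw [← mul_assoc, ← sq, hsq]
      _ = √(q : ℝ) := by rw [hsr, mul_one]
  refine opNorm_le_of_schur A (fun x y => if G.Adj x y then 1 else 0) (fun x y => ?_)
    (fun x y => ?_) (fun x y => ?_) (fun x => r ^ G.dist o x) (fun x => by positivity)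
    (by positivity) fun x F => ?_
  · rw [hA]
    split_ifs <;> simp
  · split_ifs <;> simp
  · simp_rw [G.adj_comm]
  · have h1 : ∑ y ∈ F, (if G.Adj x y then (1 : ℝ) else 0) * r ^ G.dist o y ≤
        ∑ y ∈ G.neighborFinset x, r ^ G.dist o y := by
      simp_rw [ite_mul, one_mul, zero_mul]
      rw [← Finset.sum_filter]
      refine Finset.sum_le_sum_of_subset_of_nonneg (fun y hy => ?_) fun _ _ _ => by positivity
      simpa using (Finset.mem_filter.1 hy).2
    refine h1.trans ?_
    rcases hn : G.dist o x with _ | n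
    · obtain rfl := hG.connected.dist_eq_zero_iff.1 hn
      rw [hdeg.sum_neighborFinset_dist_self o (fun n => r ^ n), pow_one, pow_zero, add_mul, hqr]
      have : r ≤ √(q : ℝ) := by
        rw [← hqr]
        nlinarith
      linarith
    · rw [hG.sum_neighborFinset_dist hdeg o x n hn (fun n => r ^ n)]
      refine le_of_eq ?_
      calc r ^ n + q * r ^ (n + 2) = r ^ n * 1 + (q * r) * r ^ (n + 1) := by ring
        _ = 2 * √(q : ℝ) * r ^ (n + 1) := by
          rw [hqr, ← hsr]
          ring

/-- The Green function of a `(q + 1)`-regular tree is a geometric function of the distance. -/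
theorem IsAdjacencyOp.entry_resR {V : Type} {G : SimpleGraph V} [G.LocallyFinite]
    {A : L2 V →L[ℂ] L2 V} (hA : IsAdjacencyOp G A) (hG : G.IsTree) {q : ℕ}
    (hdeg : G.IsRegularOfDegree (q + 1)) {l a μ : ℝ} (hl : ‖A‖ < l)
    (hqa : q * a ^ 2 < 1) (ha : q * a ^ 2 - l * a + 1 = 0) (hμ : μ = l - (q + 1) * a)
    (hμ0 : μ ≠ 0) (x o : V) : entry (ResR A l) x o = (a ^ G.dist o x / μ : ℝ) := by
  have hmem : Memℓp (fun x => ((a ^ G.dist o x / μ : ℝ) : ℂ)) 2 := by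
    refine memℓp_gen' (C := (1 + a ^ 2) / (1 - q * a ^ 2) / μ ^ 2) fun F => ?_
    have h (x : V) : ‖((a ^ G.dist o x / μ : ℝ) : ℂ)‖ ^ (2 : ℝ≥0∞).toReal =
        (a ^ 2) ^ G.dist o x / μ ^ 2 := by
      rw [Complex.norm_real, ENNReal.toReal_ofNat, Real.rpow_ofNat, Real.norm_eq_abs, sq_abs,
        div_pow, ← pow_mul, ← pow_mul, mul_comm]
    simp_rw [h]
    rw [← Finset.sum_div]
    exact div_le_div_of_nonneg_right (hG.sum_pow_dist_le hdeg o (sq_nonneg a) hqa F)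
      (sq_nonneg μ)
  let u : L2 V := ⟨_, hmem⟩
  have hu (x : V) : (u : ∀ _ : V, ℂ) x = ((a ^ G.dist o x / μ : ℝ) : ℂ) := rfl
  set B : L2 V →L[ℂ] L2 V := (l : ℂ) • (1 : L2 V →L[ℂ] L2 V) - A
  have hBu : B u = delta o := by
    ext x
    have h1 : B u = (l : ℂ) • u - A u := rfl
    have hval : (B u : ∀ _ : V, ℂ) x =
        ((l * (a ^ G.dist o x / μ) -
          ∑ y ∈ G.neighborFinset x, a ^ G.dist o y / μ : ℝ) : ℂ) := by
      rw [h1, lp.coeFn_sub, Pi.sub_apply, lp.coeFn_smul, Pi.smul_apply, hA.apply_eq_sum]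
      simp_rw [hu]
      push_cast
      rfl
    rw [hval, delta_apply]
    rcases hn : G.dist o x with _ | n
    · obtain rfl := hG.connected.dist_eq_zero_iff.1 hn
      rw [hdeg.sum_neighborFinset_dist_self o (fun n => a ^ n / μ), if_pos rfl]
      have : l * (a ^ 0 / μ) - (q + 1) * (a ^ 1 / μ) = 1 := by
        field_simp
        rw [hμ]
      rw [this, Complex.ofReal_one]
    · have hx : x ≠ o := by
        rintro rfl
        simp at hn
      rw [hG.sum_neighborFinset_dist hdeg o x n hn (fun n => a ^ n / μ), if_neg hx]
      have : l * (a ^ (n + 1) / μ) - (a ^ n / μ + q * (a ^ (n + 2) / μ)) =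
          -(a ^ n / μ) * (q * a ^ 2 - l * a + 1) := by ring
      rw [this, ha, mul_zero, Complex.ofReal_zero]
  have hunit : IsUnit B := by
    have h : (l : ℂ) ∈ resolventSet ℂ A := by
      nontriviality (L2 V →L[ℂ] L2 V)
      refine spectrum.mem_resolventSet_of_norm_lt_mul ?_
      rw [Complex.norm_real]
      refine lt_of_le_of_lt ?_ (hl.trans_le (le_abs_self l))
      exact mul_le_of_le_one_right (norm_nonneg _) ContinuousLinearMap.norm_id_le
    rw [spectrum.mem_resolventSet_iff, Algebra.algebraMap_eq_smul_one] at h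
    exact h
  have hR : ResR A l (delta o) = u := by
    rw [← hBu]
    change (Ring.inverse B * B) u = u
    rw [Ring.inverse_mul_cancel B hunit]
    rfl
  rw [entry, hR, hu]

theorem IsProjFamily.entry_compression {V : Type} {P : Set V → (L2 V →L[ℂ] L2 V)}
    (hP : IsProjFamily P) (S : Set V) (T : L2 V →L[ℂ] L2 V) (x y : V) :
    entry (P S ∘L T ∘L P S) x y = if x ∈ S ∧ y ∈ S then entry T x y else 0 := by
  have h : P S (delta y) = if y ∈ S then delta y else 0 := by
    ext x
    rw [hP]
    by_cases hy : y ∈ S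
    · rw [if_pos hy, delta_apply]
      split_ifs <;> simp_all
    · rw [if_neg hy, delta_apply]
      split_ifs <;> simp_all
  rw [entry, ContinuousLinearMap.comp_apply, ContinuousLinearMap.comp_apply, hP, h]
  by_cases hy : y ∈ S <;> by_cases hx : x ∈ S <;> simp [hx, hy, entry]

theorem IsProjFamily.opNorm_le_one {V : Type} {P : Set V → (L2 V →L[ℂ] L2 V)}
    (hP : IsProjFamily P) (S : Set V) : ‖P S‖ ≤ 1 := by
  refine (P S).opNorm_le_bound zero_le_one fun f => ?_
  rw [one_mul]
  refine lp.norm_mono (by simp) fun x => ?_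
  rw [hP]
  split_ifs <;> simp

theorem IsProjFamily.opNorm_compression_mono {V : Type} {P : Set V → (L2 V →L[ℂ] L2 V)}
    (hP : IsProjFamily P) {S S' : Set V} (h : S ⊆ S') (T : L2 V →L[ℂ] L2 V) :
    ‖P S ∘L T ∘L P S‖ ≤ ‖P S' ∘L T ∘L P S'‖ := by
  have h1 : P S ∘L P S' = P S := by
    ext f x
    rw [ContinuousLinearMap.comp_apply, hP, hP, hP]
    split_ifs with hx hx'
    · rfl
    · exact absurd (h hx) hx'
    · rfl
  have h2 : P S' ∘L P S = P S := by
    ext f x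
    rw [ContinuousLinearMap.comp_apply, hP, hP]
    split_ifs with hx hxS hxS
    · rfl
    · rfl
    · exact absurd (h hxS) hx
    · rfl
  have h3 : P S ∘L T ∘L P S = P S ∘L (P S' ∘L T ∘L P S') ∘L P S := by
    calc _ = (P S ∘L P S') ∘L T ∘L (P S' ∘L P S) := by rw [h1, h2]
      _ = _ := rfl
  rw [h3]
  calc _ ≤ ‖P S‖ * (‖P S' ∘L T ∘L P S'‖ * ‖P S‖) :=
        (ContinuousLinearMap.opNorm_comp_le _ _).trans (by
          gcongr
          exact ContinuousLinearMap.opNorm_comp_le _ _)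
    _ ≤ 1 * (‖P S' ∘L T ∘L P S'‖ * 1) := by
        gcongr <;> exact hP.opNorm_le_one S
    _ = _ := by ring

theorem aF_muF_properties {Q : ℕ} (hQ : 3 ≤ Q) {l : ℝ} (hl : 2 * √((Q : ℝ) - 1) < l) :
    0 < aF Q l ∧ aF Q l < 1 ∧ ((Q : ℝ) - 1) * aF Q l ^ 2 < 1 ∧
      ((Q : ℝ) - 1) * aF Q l ^ 2 - l * aF Q l + 1 = 0 ∧
      muF Q l = l - Q * aF Q l ∧ 0 < muF Q l := by
  have hQ' : (3 : ℝ) ≤ Q := by exact_mod_cast hQ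
  obtain ⟨q, hq⟩ : ∃ q : ℝ, q = (Q : ℝ) - 1 := ⟨_, rfl⟩
  have hQq : (Q : ℝ) = q + 1 := by linarith
  unfold aF muF
  rw [← hq] at hl ⊢
  rw [hQq]
  have hq2 : 2 ≤ q := by linarith
  have hl0 : 0 < l := lt_of_le_of_lt (by positivity) hl
  have hsq : 4 * q < l ^ 2 := by
    have h := Real.sq_sqrt (show 0 ≤ q by linarith)
    nlinarith [Real.sqrt_nonneg q]
  have hlt : 4 * q / l ^ 2 < 1 := (div_lt_one (by positivity)).2 hsq
  have hpos : 0 < 4 * q / l ^ 2 := by positivity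
  set s := √(1 - 4 * q / l ^ 2)
  have hs0 : 0 < s := Real.sqrt_pos.2 (by linarith)
  have hss : s ^ 2 = 1 - 4 * q / l ^ 2 := Real.sq_sqrt (by linarith)
  have hs1 : s < 1 := by nlinarith
  have hls : l ^ 2 * (1 - s ^ 2) = 4 * q := by
    rw [hss]
    field_simp
    ring
  set a := l * (1 - s) / (2 * q) with ha
  have hqa : 2 * q * a = l * (1 - s) := by
    rw [ha]
    field_simp
  have ha0 : 0 < a := by
    have : 0 < 1 - s := by linarith
    positivity
  have hquad : q * a ^ 2 - l * a + 1 = 0 := by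
    have h : 4 * q * (q * a ^ 2 - l * a + 1) = 0 := by
      calc _ = (2 * q * a) ^ 2 - 2 * l * (2 * q * a) + 4 * q := by ring
        _ = 0 := by
          rw [hqa, ← hls]
          ring
    exact (mul_eq_zero.1 h).resolve_left (by positivity)
  have hqa2 : q * a ^ 2 < 1 := by
    have : 2 * q * a < l := by rw [hqa]; nlinarith
    nlinarith
  refine ⟨ha0, by nlinarith, hqa2, hquad, ?_, by
    have : 0 < q + 1 - 2 + (q + 1) * s := by nlinarith
    positivity⟩
  rw [ha]
  field_simp
  ring

/-- **Lemma 5.1 (equation (5.1)).** For the Cayley tree of degree `Q`, a two-sided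
infinite geodesic `Z` and a one-sided infinite geodesic ray `N ⊂ Z`, the compressions of
the resolvent to `ℓ²(Z)` and to `ℓ²(N)` have the same norm
`(1 + a(λ))/(μ(λ)(1 − a(λ)))`, for every `λ > 2√(Q−1)`. -/
theorem compressed_resolvent_norm_Z_and_N (Q : ℕ) (hQ : 3 ≤ Q)
    {V : Type} (G : SimpleGraph V) (hG : IsCayleyTree G Q)
    (A : L2 V →L[ℂ] L2 V) (hA : IsAdjacencyOp G A) (hsa : IsSelfAdjoint A)
    (P : Set V → (L2 V →L[ℂ] L2 V)) (hP : IsProjFamily P)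
    (Z : Set V) (hZ : IsRegularSubtree G Z 2)
    (ray : ℕ → V) (hinj : Function.Injective ray)
    (hadj : ∀ k : ℕ, G.Adj (ray k) (ray (k + 1)))
    (hsub : Set.range ray ⊆ Z)
    (l : ℝ) (hl : 2 * Real.sqrt ((Q : ℝ) - 1) < l) :
    ‖P Z ∘L ResR A l ∘L P Z‖ = (1 + aF Q l) / (muF Q l * (1 - aF Q l)) ∧
    ‖P (Set.range ray) ∘L ResR A l ∘L P (Set.range ray)‖ =
      (1 + aF Q l) / (muF Q l * (1 - aF Q l)) := by
  obtain ⟨q, rfl⟩ : ∃ q, Q = q + 1 := ⟨Q - 1, by omega⟩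
  have hQq : ((q + 1 : ℕ) : ℝ) - 1 = q := by push_cast; ring
  obtain ⟨ha0, ha1, hqa, hquad, hμ, hμ0⟩ := aF_muF_properties hQ hl
  rw [hQq] at hl hqa hquad
  set a := aF (q + 1) l
  set μ := muF (q + 1) l
  have hT : G.IsTree := ⟨hG.conn, hG.acyc⟩
  have : G.LocallyFinite := fun v =>
    (Set.finite_of_ncard_ne_zero (by rw [hG.deg v]; omega)).fintype
  have hdeg : G.IsRegularOfDegree (q + 1) := fun v => by
    rw [← hG.deg v, ← SimpleGraph.card_neighborSet_eq_degree, Set.ncard_eq_toFinset_card',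
      Set.toFinset_card]
  have hentry := hA.entry_resR hT hdeg ((hA.opNorm_le hT (by omega) hdeg).trans_lt hl) hqa hquad
    (by rw [hμ]; push_cast; rfl) hμ0.ne'
  have hval : (1 + a) / (μ * (1 - a)) = μ⁻¹ * ((1 + a) / (1 - a)) := by
    rw [← div_div, div_right_comm, div_eq_inv_mul]
  have h1a : 0 < 1 - a := by linarith
  have hrange (n : ℕ) : ray n ∈ Set.range ray := ⟨n, rfl⟩
  have hlower : (1 + a) / (μ * (1 - a)) ≤
      ‖P (Set.range ray) ∘L ResR A l ∘L P (Set.range ray)‖ := by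
    rw [hval]
    refine le_opNorm_of_entry_ray _ hinj ha0.le ha1 (inv_nonneg.2 hμ0.le) fun i j => ?_
    rw [hP.entry_compression, if_pos ⟨hrange i, hrange j⟩, hentry, div_eq_inv_mul]
    congr 3
    rcases le_total i j with h | h
    · obtain ⟨n, rfl⟩ := Nat.exists_eq_add_of_le h
      rw [SimpleGraph.dist_comm, hT.dist_of_injective_of_adj hinj hadj]
      omega
    · obtain ⟨n, rfl⟩ := Nat.exists_eq_add_of_le h
      rw [hT.dist_of_injective_of_adj hinj hadj]
      omega
  have hupper : ‖P Z ∘L ResR A l ∘L P Z‖ ≤ (1 + a) / (μ * (1 - a)) := by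
    have hTZ : (G.induce Z).IsTree := ⟨hZ.1, hG.acyc.induce Z⟩
    have himage (z : Z) :
        (↑) '' (G.induce Z).neighborSet z = {y : V | y ∈ Z ∧ G.Adj z y} := by
      ext y
      simp [and_comm]
    have hcard (z : Z) : ((G.induce Z).neighborSet z).ncard = 2 := by
      rw [← hZ.2 z z.2, ← himage, Set.ncard_image_of_injective _ Subtype.val_injective]
    have : (G.induce Z).LocallyFinite := fun z =>
      (Set.finite_of_ncard_ne_zero (by rw [hcard z]; omega)).fintype
    have hdegZ : (G.induce Z).IsRegularOfDegree (1 + 1) := fun z => by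
      rw [one_add_one_eq_two, ← hcard z, ← SimpleGraph.card_neighborSet_eq_degree, Set.ncard_eq_toFinset_card',
        Set.toFinset_card]
    refine opNorm_le_of_schur _ (fun x y => if x ∈ Z ∧ y ∈ Z then a ^ G.dist y x / μ else 0)
      (fun x y => ?_) (fun x y => ?_) (fun x y => ?_) (fun _ => 1) (fun _ => one_pos)
      (by positivity) fun x F => ?_
    · rw [hP.entry_compression, hentry]
      split_ifs <;> simp
    · split_ifs <;> positivity
    · simp only [and_comm, SimpleGraph.dist_comm]
    · simp only [mul_one]
      by_cases hx : x ∈ Z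
      · simp only [hx, true_and]
        rw [← Finset.sum_filter, ← Finset.sum_div, mul_comm μ, ← div_div]
        refine div_le_div_of_nonneg_right ?_ hμ0.le
        have h := hTZ.sum_pow_dist_le hdegZ ⟨x, hx⟩ ha0.le (by simpa using ha1)
          (F.subtype (· ∈ Z))
        simp_rw [hG.acyc.dist_induce hZ.1] at h
        rw [Finset.sum_subtype_eq_sum_filter (f := fun y => a ^ G.dist x y)] at h
        simpa [SimpleGraph.dist_comm] using h
      · simp only [hx, false_and, if_false, Finset.sum_const_zero]
        positivity
  have hmono := hP.opNorm_compression_mono hsub (ResR A l)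
  exact ⟨le_antisymm hupper (hlower.trans hmono), le_antisymm (hmono.trans hupper) hlower⟩
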